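/- arXiv:2002.06558 — 2 statements merged into one kernel-verified Lean document; each statement's English description precedes it below -/
import Mathlib

section
/- Let n be a positive integer and let W₁, W₂ be two non-empty closed spherically convex subsets of the unit sphere Sⁿ ⊆ ℝ^{n+1}. Then W₁ ∩ W₂ = ∅ if and only if the set V = {P ∈ Sⁿ | P·Q > 0 for all Q ∈ W₁ and P·R < 0 for all R ∈ W₂} is non-empty, open in Sⁿ, and spherically convex. -/
open scoped RealInnerProductSpace

/-- A subset `W` of the unit sphere `Sⁿ ⊆ ℝ^{n+1}` is spherically convex if it is
hemispherical (there is `P ∈ Sⁿ` with `P·Q > 0` for all `Q ∈ W`) and for any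
`P, Q ∈ W` and `t ∈ [0,1]` the unit vector `(tP + (1-t)Q)/‖tP + (1-t)Q‖` lies in `W`. -/
def SphericallyConvex {n : ℕ} (W : Set (EuclideanSpace ℝ (Fin (n + 1)))) : Prop :=
  (∃ P ∈ Metric.sphere (0 : EuclideanSpace ℝ (Fin (n + 1))) 1, ∀ Q ∈ W, 0 < ⟪P, Q⟫) ∧
    ∀ P ∈ W, ∀ Q ∈ W, ∀ t ∈ Set.Icc (0 : ℝ) 1,
      ‖t • P + (1 - t) • Q‖⁻¹ • (t • P + (1 - t) • Q) ∈ W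

open scoped Pointwise

section Separation

variable {E : Type*} [NormedAddCommGroup E] [InnerProductSpace ℝ E]

/-- The cone of nonzero vectors whose normalization lies in a hemispherical, spherically convex
set is convex. -/
theorem convex_setOf_normalize_mem {W : Set E} {P : E} (hP : ∀ Q ∈ W, 0 < ⟪P, Q⟫)
    (hW : ∀ p ∈ W, ∀ q ∈ W, ∀ t ∈ Set.Icc (0 : ℝ) 1,
      ‖t • p + (1 - t) • q‖⁻¹ • (t • p + (1 - t) • q) ∈ W) :
    Convex ℝ {x : E | x ≠ 0 ∧ ‖x‖⁻¹ • x ∈ W} := by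
  rw [convex_iff_forall_pos]
  rintro x ⟨hx0, hx⟩ y ⟨hy0, hy⟩ a b ha hb -
  have hnx : 0 < ‖x‖ := norm_pos_iff.2 hx0
  have hny : 0 < ‖y‖ := norm_pos_iff.2 hy0
  have hPx : 0 < ⟪P, x⟫ := by
    have h := hP _ hx
    rw [inner_smul_right] at h
    exact pos_of_mul_pos_right h (by positivity)
  have hPy : 0 < ⟪P, y⟫ := by
    have h := hP _ hy
    rw [inner_smul_right] at h
    exact pos_of_mul_pos_right h (by positivity)
  refine ⟨fun h => ?_, ?_⟩
  · have h' : 0 < ⟪P, a • x + b • y⟫ := by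
      rw [inner_add_right, inner_smul_right, inner_smul_right]
      positivity
    simp [h] at h'
  · set c := a * ‖x‖ + b * ‖y‖ with hc
    have hc0 : 0 < c := by positivity
    have hmem := hW _ hx _ hy (a * ‖x‖ / c)
      ⟨by positivity, (div_le_one hc0).2 (by rw [hc]; nlinarith [mul_pos hb hny])⟩
    have hcomb : (a * ‖x‖ / c) • ‖x‖⁻¹ • x + (1 - a * ‖x‖ / c) • ‖y‖⁻¹ • y
        = c⁻¹ • (a • x + b • y) := by
      have h1 : 1 - a * ‖x‖ / c = b * ‖y‖ / c := by
        rw [eq_div_iff hc0.ne', sub_mul, div_mul_cancel₀ _ hc0.ne', hc]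
        ring
      rw [h1, smul_add, smul_smul, smul_smul, smul_smul, smul_smul]
      congr 2 <;> field_simp
    rwa [hcomb, norm_smul, norm_inv, Real.norm_of_nonneg hc0.le, mul_inv, inv_inv, smul_smul,
      mul_right_comm, mul_inv_cancel₀ hc0.ne', one_mul] at hmem

/-- A compact convex set avoiding the origin lies in an open half-space bounded by a hyperplane
through the origin. -/
theorem exists_forall_inner_pos_of_zero_notMem [CompleteSpace E] {S : Set E} (hS : Convex ℝ S)
    (hcl : IsClosed S) (h0 : (0 : E) ∉ S) : ∃ P : E, ∀ x ∈ S, 0 < ⟪P, x⟫ := by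
  obtain ⟨f, u, hu, hf⟩ := geometric_hahn_banach_point_closed hS hcl h0
  refine ⟨(InnerProductSpace.toDual ℝ E).symm f, fun x hx => ?_⟩
  rw [InnerProductSpace.toDual_symm_apply]
  rw [map_zero] at hu
  exact hu.trans (hf x hx)

/-- Being positive against every vector of a compact set is an open condition. -/
theorem IsCompact.isOpen_setOf_forall_inner_pos {T : Set E} (hT : IsCompact T) :
    IsOpen {x : E | ∀ Q ∈ T, 0 < ⟪x, Q⟫} := by
  rw [isOpen_iff_eventually]
  intro x hx
  refine hT.eventually_forall_of_forall_eventually fun Q hQ => ?_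
  exact (isOpen_lt continuous_const (continuous_inner (𝕜 := ℝ) (E := E))).mem_nhds (hx Q hQ)

/-- A compact, hemispherical, spherically convex subset of the unit sphere has a compact convex
radial rescaling. -/
theorem exists_isCompact_convex_radial_rescaling {W : Set E} {P : E} (hcpt : IsCompact W)
    (hsub : W ⊆ Metric.sphere 0 1) (hP : ∀ Q ∈ W, 0 < ⟪P, Q⟫)
    (hW : ∀ p ∈ W, ∀ q ∈ W, ∀ t ∈ Set.Icc (0 : ℝ) 1,
      ‖t • p + (1 - t) • q‖⁻¹ • (t • p + (1 - t) • q) ∈ W) :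
    ∃ A : Set E, IsCompact A ∧ Convex ℝ A ∧ (∀ x ∈ A, x ≠ 0 ∧ ‖x‖⁻¹ • x ∈ W) ∧
      ∀ Q ∈ W, ∃ r : ℝ, 0 < r ∧ r • Q ∈ A := by
  have himage : (fun Q => ⟪P, Q⟫⁻¹ • Q) '' W =
      {x : E | x ≠ 0 ∧ ‖x‖⁻¹ • x ∈ W} ∩ {x : E | ⟪P, x⟫ = 1} := by
    ext x
    constructor
    · rintro ⟨Q, hQ, rfl⟩
      have hQ1 : ‖Q‖ = 1 := mem_sphere_zero_iff_norm.1 (hsub hQ)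
      have hPQ := hP Q hQ
      refine ⟨⟨smul_ne_zero (inv_ne_zero hPQ.ne') fun h => by simp [h] at hQ1, ?_⟩, ?_⟩
      · rwa [norm_smul, hQ1, mul_one, norm_inv, Real.norm_of_nonneg hPQ.le, inv_inv, smul_smul,
          mul_inv_cancel₀ hPQ.ne', one_smul]
      · change ⟪P, ⟪P, Q⟫⁻¹ • Q⟫ = 1
        rw [inner_smul_right, inv_mul_cancel₀ hPQ.ne']
    · rintro ⟨⟨hx0, hx⟩, hPx : ⟪P, x⟫ = 1⟩
      refine ⟨_, hx, ?_⟩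
      change ⟪P, ‖x‖⁻¹ • x⟫⁻¹ • ‖x‖⁻¹ • x = x
      rw [inner_smul_right, hPx, mul_one, inv_inv, smul_smul,
        mul_inv_cancel₀ (norm_ne_zero_iff.2 hx0), one_smul]
  refine ⟨(fun Q => ⟪P, Q⟫⁻¹ • Q) '' W, hcpt.image_of_continuousOn ?_, ?_, ?_, fun Q hQ =>
    ⟨⟪P, Q⟫⁻¹, inv_pos.2 (hP Q hQ), Set.mem_image_of_mem _ hQ⟩⟩
  · exact ((by fun_prop : ContinuousOn (fun Q => ⟪P, Q⟫) W).inv₀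
      fun Q hQ => (hP Q hQ).ne').smul continuousOn_id
  · rw [himage]
    exact (convex_setOf_normalize_mem hP hW).inter
      (convex_hyperplane (innerₛₗ ℝ P).isLinear 1)
  · rw [himage]
    exact fun x hx => hx.1

/-- The convex join of two compact sets is compact. -/
theorem IsCompact.convexJoin {A B : Set E} (hA : IsCompact A) (hB : IsCompact B) :
    IsCompact (convexJoin ℝ A B) := by
  have h := ((isCompact_Icc (a := (0 : ℝ)) (b := 1)).prod (hA.prod hB)).image
    (by fun_prop : Continuous fun z : ℝ × E × E => (1 - z.1) • z.2.1 + z.1 • z.2.2)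
  convert h using 1
  ext x
  simp only [mem_convexJoin, segment_eq_image, Set.mem_image, Prod.exists, Set.mem_prod]
  constructor
  · rintro ⟨a, ha, b, hb, t, ht, rfl⟩
    exact ⟨t, a, b, ⟨ht, ha, hb⟩, rfl⟩
  · rintro ⟨t, a, b, ⟨ht, ha, hb⟩, rfl⟩
    exact ⟨a, ha, b, hb, t, ht, rfl⟩

/-- Two compact convex sets with no common direction are strictly separated by a hyperplane
through the origin. -/
theorem exists_inner_pos_inner_neg [CompleteSpace E] {A B : Set E}
    (hA : IsCompact A) (hB : IsCompact B) (hneA : A.Nonempty) (hneB : B.Nonempty)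
    (hconvA : Convex ℝ A) (hconvB : Convex ℝ B) (h0A : (0 : E) ∉ A) (h0B : (0 : E) ∉ B)
    (hdir : ∀ x ∈ A, ∀ y ∈ B, ‖x‖⁻¹ • x ≠ ‖y‖⁻¹ • y) :
    ∃ P : E, (∀ x ∈ A, 0 < ⟪P, x⟫) ∧ ∀ y ∈ B, ⟪P, y⟫ < 0 := by
  have h0 : (0 : E) ∉ convexJoin ℝ A (-B) := by
    rw [mem_convexJoin]
    rintro ⟨c, hc, d, hd, a, b, ha, hb, hab, h⟩
    have heq : a • c = b • -d := by rw [smul_neg]; exact eq_neg_of_add_eq_zero_left h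
    have ha' : 0 < a := by
      refine ha.lt_of_ne fun h' => ?_
      subst h'
      obtain rfl : b = 1 := by linarith
      obtain rfl : d = 0 := by simpa using heq.symm
      exact h0B (by simpa using hd)
    have hb' : 0 < b := by
      refine hb.lt_of_ne fun h' => ?_
      subst h'
      obtain rfl : a = 1 := by linarith
      obtain rfl : c = 0 := by simpa using heq
      exact h0A hc
    have key : ∀ (r : ℝ) (v : E), 0 < r → ‖r • v‖⁻¹ • r • v = ‖v‖⁻¹ • v := by
      intro r v hr
      rw [norm_smul, Real.norm_of_nonneg hr.le, smul_smul, mul_inv, mul_right_comm,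
        inv_mul_cancel₀ hr.ne', one_mul]
    refine hdir c hc (-d) hd ?_
    rw [← key a c ha', heq, key b _ hb']
  obtain ⟨P, hP⟩ := exists_forall_inner_pos_of_zero_notMem (hconvA.convexJoin hconvB.neg)
    (hA.convexJoin hB.neg).isClosed h0
  refine ⟨P, fun x hx => hP x (subset_convexJoin_left hneB.neg hx), fun y hy => ?_⟩
  have h := hP (-y) (subset_convexJoin_right hneA (by simpa using hy))
  rwa [inner_neg_right, neg_pos] at h

/-- Disjoint nonempty compact, hemispherical, spherically convex subsets of the unit sphere are
strictly separated by a hyperplane through the origin. -/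
theorem exists_inner_pos_inner_neg_of_disjoint [CompleteSpace E] {W₁ W₂ : Set E} {P₁ P₂ : E}
    (hcpt₁ : IsCompact W₁) (hcpt₂ : IsCompact W₂) (hne₁ : W₁.Nonempty) (hne₂ : W₂.Nonempty)
    (hsub₁ : W₁ ⊆ Metric.sphere 0 1) (hsub₂ : W₂ ⊆ Metric.sphere 0 1)
    (hP₁ : ∀ Q ∈ W₁, 0 < ⟪P₁, Q⟫) (hP₂ : ∀ Q ∈ W₂, 0 < ⟪P₂, Q⟫)
    (hW₁ : ∀ p ∈ W₁, ∀ q ∈ W₁, ∀ t ∈ Set.Icc (0 : ℝ) 1,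
      ‖t • p + (1 - t) • q‖⁻¹ • (t • p + (1 - t) • q) ∈ W₁)
    (hW₂ : ∀ p ∈ W₂, ∀ q ∈ W₂, ∀ t ∈ Set.Icc (0 : ℝ) 1,
      ‖t • p + (1 - t) • q‖⁻¹ • (t • p + (1 - t) • q) ∈ W₂)
    (hdisj : W₁ ∩ W₂ = ∅) :
    ∃ P : E, (∀ Q ∈ W₁, 0 < ⟪P, Q⟫) ∧ ∀ R ∈ W₂, ⟪P, R⟫ < 0 := by
  obtain ⟨A, hA, hconvA, hAW, hWA⟩ :=
    exists_isCompact_convex_radial_rescaling hcpt₁ hsub₁ hP₁ hW₁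
  obtain ⟨B, hB, hconvB, hBW, hWB⟩ :=
    exists_isCompact_convex_radial_rescaling hcpt₂ hsub₂ hP₂ hW₂
  obtain ⟨P, hPA, hPB⟩ := exists_inner_pos_inner_neg hA hB
    (hne₁.elim fun Q hQ => (hWA Q hQ).elim fun r hr => ⟨r • Q, hr.2⟩)
    (hne₂.elim fun Q hQ => (hWB Q hQ).elim fun r hr => ⟨r • Q, hr.2⟩)
    hconvA hconvB (fun h => (hAW 0 h).1 rfl) (fun h => (hBW 0 h).1 rfl)
    (fun x hx y hy h => Set.eq_empty_iff_forall_notMem.1 hdisj _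
      ⟨(hAW x hx).2, h ▸ (hBW y hy).2⟩)
  refine ⟨P, fun Q hQ => ?_, fun R hR => ?_⟩
  · obtain ⟨r, hr, hrQ⟩ := hWA Q hQ
    have h := hPA _ hrQ
    rw [inner_smul_right] at h
    exact pos_of_mul_pos_right h hr.le
  · obtain ⟨r, hr, hrR⟩ := hWB R hR
    have h := hPB _ hrR
    rw [inner_smul_right] at h
    exact neg_of_mul_neg_right h hr.le

end Separation

/-- A subset of the sphere that is closed relative to the sphere is compact. -/
theorem isCompact_of_isClosed_in_sphere {n : ℕ} {W : Set (EuclideanSpace ℝ (Fin (n + 1)))}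
    (hsub : W ⊆ Metric.sphere 0 1)
    (hcl : IsClosed {x : Metric.sphere (0 : EuclideanSpace ℝ (Fin (n + 1))) 1 |
      (x : EuclideanSpace ℝ (Fin (n + 1))) ∈ W}) : IsCompact W := by
  have h := hcl.isCompact.image continuous_subtype_val
  rwa [show Subtype.val '' {x : Metric.sphere (0 : EuclideanSpace ℝ (Fin (n + 1))) 1 |
      (x : EuclideanSpace ℝ (Fin (n + 1))) ∈ W} = W from
    Subtype.image_preimage_coe _ _ |>.trans (Set.inter_eq_right.2 hsub)] at h

theorem stmt_0 (n : ℕ) (hn : 0 < n)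
    (W₁ W₂ : Set (EuclideanSpace ℝ (Fin (n + 1))))
    (hW₁sub : W₁ ⊆ Metric.sphere 0 1) (hW₂sub : W₂ ⊆ Metric.sphere 0 1)
    (hW₁ne : W₁.Nonempty) (hW₂ne : W₂.Nonempty)
    (hW₁cl : IsClosed {x : Metric.sphere (0 : EuclideanSpace ℝ (Fin (n + 1))) 1 |
      (x : EuclideanSpace ℝ (Fin (n + 1))) ∈ W₁})
    (hW₂cl : IsClosed {x : Metric.sphere (0 : EuclideanSpace ℝ (Fin (n + 1))) 1 |
      (x : EuclideanSpace ℝ (Fin (n + 1))) ∈ W₂})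
    (hW₁conv : SphericallyConvex W₁) (hW₂conv : SphericallyConvex W₂) :
    W₁ ∩ W₂ = ∅ ↔
      ({P : EuclideanSpace ℝ (Fin (n + 1)) | P ∈ Metric.sphere 0 1 ∧
          (∀ Q ∈ W₁, 0 < ⟪P, Q⟫) ∧ (∀ R ∈ W₂, ⟪P, R⟫ < 0)}.Nonempty ∧
        IsOpen {x : Metric.sphere (0 : EuclideanSpace ℝ (Fin (n + 1))) 1 |
          (∀ Q ∈ W₁, 0 < ⟪(x : EuclideanSpace ℝ (Fin (n + 1))), Q⟫) ∧
          (∀ R ∈ W₂, ⟪(x : EuclideanSpace ℝ (Fin (n + 1))), R⟫ < 0)} ∧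
        SphericallyConvex {P : EuclideanSpace ℝ (Fin (n + 1)) | P ∈ Metric.sphere 0 1 ∧
          (∀ Q ∈ W₁, 0 < ⟪P, Q⟫) ∧ (∀ R ∈ W₂, ⟪P, R⟫ < 0)}) := by
  constructor
  · intro hdisj
    have hcpt₁ := isCompact_of_isClosed_in_sphere hW₁sub hW₁cl
    have hcpt₂ := isCompact_of_isClosed_in_sphere hW₂sub hW₂cl
    obtain ⟨Q₀, hQ₀⟩ := hW₁ne
    refine ⟨?_, ?_, ⟨Q₀, hW₁sub hQ₀, fun P hP => ?_⟩, ?_⟩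
    · obtain ⟨P, hP₁, hP₂⟩ := exists_inner_pos_inner_neg_of_disjoint hcpt₁ hcpt₂ ⟨Q₀, hQ₀⟩ hW₂ne
        hW₁sub hW₂sub hW₁conv.1.choose_spec.2 hW₂conv.1.choose_spec.2 hW₁conv.2 hW₂conv.2 hdisj
      have hP0 : P ≠ 0 := by
        rintro rfl
        simpa using hP₁ Q₀ hQ₀
      have hinv : 0 < ‖P‖⁻¹ := inv_pos.2 (norm_pos_iff.2 hP0)
      refine ⟨‖P‖⁻¹ • P, ?_, fun Q hQ => ?_, fun R hR => ?_⟩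
      · rw [mem_sphere_zero_iff_norm, norm_smul, norm_inv, norm_norm,
          inv_mul_cancel₀ (norm_ne_zero_iff.2 hP0)]
      · rw [real_inner_smul_left]
        exact mul_pos hinv (hP₁ Q hQ)
      · rw [real_inner_smul_left]
        exact mul_neg_of_pos_of_neg hinv (hP₂ R hR)
    · convert (hcpt₁.isOpen_setOf_forall_inner_pos.inter
        hcpt₂.neg.isOpen_setOf_forall_inner_pos).preimage
        (continuous_subtype_val (p := (· ∈ Metric.sphere 0 1))) using 1
      ext x
      simp only [Set.mem_ofPred_eq, Set.mem_preimage, Set.mem_inter_iff]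
      refine and_congr_right fun _ => ⟨fun h Q hQ => ?_, fun h R hR => ?_⟩
      · simpa using h (-Q) hQ
      · simpa using h (-R) (by simpa using hR)
    · rw [real_inner_comm]
      exact hP.2.1 Q₀ hQ₀
    · rintro p ⟨-, hp₁, hp₂⟩ q ⟨-, hq₁, hq₂⟩ t ht
      have hpos : ∀ Q ∈ W₁, 0 < ⟪t • p + (1 - t) • q, Q⟫ := fun Q hQ => by
        rw [inner_add_left, real_inner_smul_left, real_inner_smul_left]
        exact (convex_Ioi (0 : ℝ)) (hp₁ Q hQ) (hq₁ Q hQ) ht.1 (sub_nonneg.2 ht.2) (by ring)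
      have hneg : ∀ R ∈ W₂, ⟪t • p + (1 - t) • q, R⟫ < 0 := fun R hR => by
        rw [inner_add_left, real_inner_smul_left, real_inner_smul_left]
        exact (convex_Iio (0 : ℝ)) (hp₂ R hR) (hq₂ R hR) ht.1 (sub_nonneg.2 ht.2) (by ring)
      have h0 : t • p + (1 - t) • q ≠ 0 := fun h => by simpa [h] using hpos Q₀ hQ₀
      have hinv : 0 < ‖t • p + (1 - t) • q‖⁻¹ := inv_pos.2 (norm_pos_iff.2 h0)
      refine ⟨?_, fun Q hQ => ?_, fun R hR => ?_⟩
      · rw [mem_sphere_zero_iff_norm, norm_smul, norm_inv, norm_norm,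
          inv_mul_cancel₀ (norm_ne_zero_iff.2 h0)]
      · rw [real_inner_smul_left]
        exact mul_pos hinv (hpos Q hQ)
      · rw [real_inner_smul_left]
        exact mul_neg_of_pos_of_neg hinv (hneg R hR)
  · rintro ⟨⟨P, -, hP₁, hP₂⟩, -⟩
    exact Set.eq_empty_iff_forall_notMem.2 fun Q hQ => lt_asymm (hP₁ Q hQ.1) (hP₂ Q hQ.2)
end

section
/- Let n be a positive integer and let W₁, W₂ be two non-empty spherically convex subsets of the unit sphere Sⁿ ⊆ ℝ^{n+1} that are open in Sⁿ. Then W₁ ∩ W₂ = ∅ if and only if the set V = {P ∈ Sⁿ | P·Q > 0 for all Q ∈ W₁ and P·R < 0 for all R ∈ W₂} is non-empty, closed in Sⁿ, and spherically convex. -/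
open scoped RealInnerProductSpace

section SphericalCone

variable {E : Type*} [NormedAddCommGroup E]

/-- The open cone over a subset of the unit sphere. -/
def sphericalCone [NormedSpace ℝ E] (W : Set E) : Set E :=
  {x | x ≠ 0 ∧ ‖x‖⁻¹ • x ∈ W}

lemma subset_sphericalCone [NormedSpace ℝ E] {W : Set E} (hW : W ⊆ Metric.sphere 0 1) :
    W ⊆ sphericalCone W := by
  intro x hx
  have h1 : ‖x‖ = 1 := by simpa using hW hx
  refine ⟨fun h => by simp [h] at h1, ?_⟩
  simpa [h1] using hx

lemma smul_mem_sphericalCone [NormedSpace ℝ E] {W : Set E} {x : E} (hx : x ∈ sphericalCone W)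
    {c : ℝ} (hc : 0 < c) : c • x ∈ sphericalCone W := by
  refine ⟨smul_ne_zero hc.ne' hx.1, ?_⟩
  have h : ‖c • x‖⁻¹ • c • x = ‖x‖⁻¹ • x := by
    rw [norm_smul, Real.norm_of_nonneg hc.le, smul_smul]
    congr 1
    field_simp
  rw [h]
  exact hx.2

lemma isOpen_sphericalCone [NormedSpace ℝ E] {W : Set E}
    (hW : IsOpen {x : Metric.sphere (0 : E) 1 | (x : E) ∈ W}) : IsOpen (sphericalCone W) := by
  obtain ⟨U, hU, hUW⟩ := isOpen_induced_iff.1 hW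
  have hcone : sphericalCone W = {0}ᶜ ∩ (fun x : E => ‖x‖⁻¹ • x) ⁻¹' U := by
    ext x
    refine and_congr_right fun hx => ?_
    have hs : ‖x‖⁻¹ • x ∈ Metric.sphere (0 : E) 1 := by
      simp [norm_smul, inv_mul_cancel₀ (norm_ne_zero_iff.2 hx)]
    exact (Set.ext_iff.1 hUW ⟨_, hs⟩).symm
  rw [hcone]
  refine ContinuousOn.isOpen_inter_preimage ?_ isOpen_compl_singleton hU
  exact (continuousOn_id.norm.inv₀ fun x hx => norm_ne_zero_iff.2 hx).smul continuousOn_id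

lemma inner_sphericalCone_nonneg [InnerProductSpace ℝ E] {W : Set E} {P : E}
    (h : ∀ Q ∈ W, 0 ≤ ⟪P, Q⟫) {x : E} (hx : x ∈ sphericalCone W) : 0 ≤ ⟪P, x⟫ := by
  have h1 := h _ hx.2
  rw [real_inner_smul_right] at h1
  exact nonneg_of_mul_nonneg_right h1 (by have := hx.1; positivity)

lemma inner_pos_of_inner_nonneg [InnerProductSpace ℝ E] {W : Set E}
    (hsub : W ⊆ Metric.sphere 0 1) (hW : IsOpen {x : Metric.sphere (0 : E) 1 | (x : E) ∈ W})
    {P : E} (hP : P ≠ 0) (h : ∀ Q ∈ W, 0 ≤ ⟪P, Q⟫) {Q : E} (hQ : Q ∈ W) : 0 < ⟪P, Q⟫ := by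
  have hev : ∀ᶠ ε : ℝ in nhdsWithin 0 (Set.Ioi 0), Q - ε • P ∈ sphericalCone W := by
    have hc : Continuous fun ε : ℝ => Q - ε • P := by fun_prop
    refine Filter.Eventually.filter_mono nhdsWithin_le_nhds
      (hc.continuousAt.eventually_mem ((isOpen_sphericalCone hW).mem_nhds ?_))
    simpa using subset_sphericalCone hsub hQ
  obtain ⟨ε, hε, hpos⟩ := (hev.and self_mem_nhdsWithin).exists
  have h1 := inner_sphericalCone_nonneg h hε
  rw [inner_sub_right, real_inner_smul_right] at h1
  have h2 : 0 < ε * ⟪P, P⟫ := mul_pos hpos (real_inner_self_pos.2 hP)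
  linarith

end SphericalCone

lemma SphericallyConvex.convex_sphericalCone {n : ℕ} {W : Set (EuclideanSpace ℝ (Fin (n + 1)))}
    (hW : SphericallyConvex W) : Convex ℝ (sphericalCone W) := by
  intro x hx y hy a b ha hb hab
  obtain ⟨⟨P, -, hP⟩, hconv⟩ := hW
  have hx0 : 0 < ‖x‖ := norm_pos_iff.2 hx.1
  have hy0 : 0 < ‖y‖ := norm_pos_iff.2 hy.1
  have hs : 0 < a * ‖x‖ + b * ‖y‖ := by
    rcases ha.eq_or_lt with rfl | ha
    · obtain rfl : b = 1 := by linarith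
      simpa using hy0
    · positivity
  set s := a * ‖x‖ + b * ‖y‖ with hsdef
  set t := a * ‖x‖ / s with ht
  have ht1 : 1 - t = b * ‖y‖ / s := by
    rw [ht]
    field_simp
    rw [hsdef]
    ring
  have ht0 : 0 ≤ t := by positivity
  have ht2 : 0 ≤ 1 - t := by rw [ht1]; positivity
  have hmem : t • (‖x‖⁻¹ • x) + (1 - t) • (‖y‖⁻¹ • y) ∈ sphericalCone W := by
    refine ⟨fun h0 => ?_, hconv _ hx.2 _ hy.2 t ⟨ht0, by linarith⟩⟩
    have h1 := congrArg (fun z => ⟪P, z⟫) h0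
    simp only [inner_add_right, inner_zero_right, real_inner_smul_right _ _ t,
      real_inner_smul_right _ _ (1 - t)] at h1
    have hp := hP _ hx.2
    have hq := hP _ hy.2
    rcases ht0.eq_or_lt with h | h
    · rw [← h] at h1
      linarith
    · nlinarith [mul_pos h hp, mul_nonneg ht2 hq.le]
  have heq : a • x + b • y = s • (t • (‖x‖⁻¹ • x) + (1 - t) • (‖y‖⁻¹ • y)) := by
    rw [ht1, ht, smul_add, smul_smul, smul_smul, smul_smul, smul_smul]
    congr 2 <;> field_simp
  rw [heq]
  exact smul_mem_sphericalCone hmem hs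

/-- Disjoint non-empty open spherically convex sets are strictly separated by a hyperplane
through the origin. -/
lemma exists_unit_separating_of_disjoint {n : ℕ} {W₁ W₂ : Set (EuclideanSpace ℝ (Fin (n + 1)))}
    (hW₁sub : W₁ ⊆ Metric.sphere 0 1) (hW₂sub : W₂ ⊆ Metric.sphere 0 1)
    (hW₁ne : W₁.Nonempty) (hW₂ne : W₂.Nonempty)
    (hW₁op : IsOpen {x : Metric.sphere (0 : EuclideanSpace ℝ (Fin (n + 1))) 1 |
      (x : EuclideanSpace ℝ (Fin (n + 1))) ∈ W₁})
    (hW₂op : IsOpen {x : Metric.sphere (0 : EuclideanSpace ℝ (Fin (n + 1))) 1 |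
      (x : EuclideanSpace ℝ (Fin (n + 1))) ∈ W₂})
    (hW₁conv : SphericallyConvex W₁) (hW₂conv : SphericallyConvex W₂) (h : W₁ ∩ W₂ = ∅) :
    ∃ P ∈ Metric.sphere (0 : EuclideanSpace ℝ (Fin (n + 1))) 1,
      (∀ Q ∈ W₁, 0 < ⟪P, Q⟫) ∧ ∀ R ∈ W₂, ⟪P, R⟫ < 0 := by
  have hdisj : Disjoint (sphericalCone W₂) (sphericalCone W₁) :=
    Set.disjoint_left.2 fun x hx2 hx1 => (Set.ext_iff.1 h _).1 ⟨hx1.2, hx2.2⟩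
  obtain ⟨f, u, hf₂, hf₁⟩ := geometric_hahn_banach_open_open hW₂conv.convex_sphericalCone
    (isOpen_sphericalCone hW₂op) hW₁conv.convex_sphericalCone (isOpen_sphericalCone hW₁op) hdisj
  have hlim : ∀ x, Filter.Tendsto (fun c : ℝ => f (c • x)) (nhdsWithin 0 (Set.Ioi 0)) (nhds 0) := by
    intro x
    have hc : Continuous fun c : ℝ => f (c • x) := by fun_prop
    simpa using (hc.tendsto 0).mono_left nhdsWithin_le_nhds
  have hu : u = 0 := by
    obtain ⟨Q, hQ⟩ := hW₁ne
    obtain ⟨R, hR⟩ := hW₂ne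
    apply le_antisymm
    · refine ge_of_tendsto (hlim Q) ?_
      filter_upwards [self_mem_nhdsWithin] with c hc
      exact (hf₁ _ (smul_mem_sphericalCone (subset_sphericalCone hW₁sub hQ) hc)).le
    · refine le_of_tendsto (hlim R) ?_
      filter_upwards [self_mem_nhdsWithin] with c hc
      exact (hf₂ _ (smul_mem_sphericalCone (subset_sphericalCone hW₂sub hR) hc)).le
  subst hu
  set v := (InnerProductSpace.toDual ℝ (EuclideanSpace ℝ (Fin (n + 1)))).symm f with hv
  have hvf : ∀ x, ⟪v, x⟫ = f x := fun x => InnerProductSpace.toDual_symm_apply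
  have hv0 : v ≠ 0 := by
    obtain ⟨Q, hQ⟩ := hW₁ne
    intro h0
    have h1 := hf₁ Q (subset_sphericalCone hW₁sub hQ)
    rw [← hvf, h0, inner_zero_left] at h1
    exact h1.false
  have hvn : 0 < ‖v‖⁻¹ := inv_pos.2 (norm_pos_iff.2 hv0)
  refine ⟨‖v‖⁻¹ • v, by simp [norm_smul, hv0], fun Q hQ => ?_, fun R hR => ?_⟩
  · rw [real_inner_smul_left, hvf]
    exact mul_pos hvn (hf₁ Q (subset_sphericalCone hW₁sub hQ))
  · rw [real_inner_smul_left, hvf]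
    exact mul_neg_of_pos_of_neg hvn (hf₂ R (subset_sphericalCone hW₂sub hR))

theorem stmt_1 (n : ℕ) (hn : 0 < n)
    (W₁ W₂ : Set (EuclideanSpace ℝ (Fin (n + 1))))
    (hW₁sub : W₁ ⊆ Metric.sphere 0 1) (hW₂sub : W₂ ⊆ Metric.sphere 0 1)
    (hW₁ne : W₁.Nonempty) (hW₂ne : W₂.Nonempty)
    (hW₁op : IsOpen {x : Metric.sphere (0 : EuclideanSpace ℝ (Fin (n + 1))) 1 |
      (x : EuclideanSpace ℝ (Fin (n + 1))) ∈ W₁})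
    (hW₂op : IsOpen {x : Metric.sphere (0 : EuclideanSpace ℝ (Fin (n + 1))) 1 |
      (x : EuclideanSpace ℝ (Fin (n + 1))) ∈ W₂})
    (hW₁conv : SphericallyConvex W₁) (hW₂conv : SphericallyConvex W₂) :
    W₁ ∩ W₂ = ∅ ↔
      ({P : EuclideanSpace ℝ (Fin (n + 1)) | P ∈ Metric.sphere 0 1 ∧
          (∀ Q ∈ W₁, 0 < ⟪P, Q⟫) ∧ (∀ R ∈ W₂, ⟪P, R⟫ < 0)}.Nonempty ∧
        IsClosed {x : Metric.sphere (0 : EuclideanSpace ℝ (Fin (n + 1))) 1 |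
          (∀ Q ∈ W₁, 0 < ⟪(x : EuclideanSpace ℝ (Fin (n + 1))), Q⟫) ∧
          (∀ R ∈ W₂, ⟪(x : EuclideanSpace ℝ (Fin (n + 1))), R⟫ < 0)} ∧
        SphericallyConvex {P : EuclideanSpace ℝ (Fin (n + 1)) | P ∈ Metric.sphere 0 1 ∧
          (∀ Q ∈ W₁, 0 < ⟪P, Q⟫) ∧ (∀ R ∈ W₂, ⟪P, R⟫ < 0)}) := by
  constructor
  · intro h
    refine ⟨exists_unit_separating_of_disjoint hW₁sub hW₂sub hW₁ne hW₂ne hW₁op hW₂op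
      hW₁conv hW₂conv h, ?_, ?_, ?_⟩
    · have heq : {x : Metric.sphere (0 : EuclideanSpace ℝ (Fin (n + 1))) 1 |
          (∀ Q ∈ W₁, 0 < ⟪(x : EuclideanSpace ℝ (Fin (n + 1))), Q⟫) ∧
          (∀ R ∈ W₂, ⟪(x : EuclideanSpace ℝ (Fin (n + 1))), R⟫ < 0)} =
          {x : Metric.sphere (0 : EuclideanSpace ℝ (Fin (n + 1))) 1 |
          (∀ Q ∈ W₁, 0 ≤ ⟪(x : EuclideanSpace ℝ (Fin (n + 1))), Q⟫) ∧
          (∀ R ∈ W₂, ⟪(x : EuclideanSpace ℝ (Fin (n + 1))), R⟫ ≤ 0)} := by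
        ext x
        have hx0 : (x : EuclideanSpace ℝ (Fin (n + 1))) ≠ 0 := ne_zero_of_mem_unit_sphere x
        refine ⟨fun hx => ⟨fun Q hQ => (hx.1 Q hQ).le, fun R hR => (hx.2 R hR).le⟩,
          fun hx => ⟨fun Q hQ => inner_pos_of_inner_nonneg hW₁sub hW₁op hx0 hx.1 hQ,
            fun R hR => ?_⟩⟩
        have h1 := inner_pos_of_inner_nonneg hW₂sub hW₂op (neg_ne_zero.2 hx0)
          (fun R hR => by simpa [inner_neg_left] using hx.2 R hR) hR
        simpa [inner_neg_left] using h1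
      rw [heq]
      simp only [Set.ofPred_and, Set.ofPred_forall]
      refine IsClosed.inter ?_ ?_
      · exact isClosed_biInter fun Q _ => isClosed_le (by fun_prop) (by fun_prop)
      · exact isClosed_biInter fun R _ => isClosed_le (by fun_prop) (by fun_prop)
    · obtain ⟨Q, hQ⟩ := hW₁ne
      exact ⟨Q, hW₁sub hQ, fun P hP => by rw [real_inner_comm]; exact hP.2.1 Q hQ⟩
    · rintro P ⟨-, hP₁, hP₂⟩ P' ⟨-, hP'₁, hP'₂⟩ t ⟨ht0, ht1⟩
      have hpos : ∀ Q ∈ W₁, 0 < ⟪t • P + (1 - t) • P', Q⟫ := by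
        intro Q hQ
        rw [inner_add_left, real_inner_smul_left, real_inner_smul_left]
        exact convex_Ioi (0 : ℝ) (hP₁ Q hQ) (hP'₁ Q hQ) ht0 (sub_nonneg.2 ht1) (by ring)
      have hneg : ∀ R ∈ W₂, ⟪t • P + (1 - t) • P', R⟫ < 0 := by
        intro R hR
        rw [inner_add_left, real_inner_smul_left, real_inner_smul_left]
        exact convex_Iio (0 : ℝ) (hP₂ R hR) (hP'₂ R hR) ht0 (sub_nonneg.2 ht1) (by ring)
      have hne : t • P + (1 - t) • P' ≠ 0 := by
        obtain ⟨Q, hQ⟩ := hW₁ne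
        intro h0
        have h1 := hpos Q hQ
        rw [h0, inner_zero_left] at h1
        exact h1.false
      have hn0 : 0 < ‖t • P + (1 - t) • P'‖ := norm_pos_iff.2 hne
      have hn1 := inv_pos.2 hn0
      refine ⟨?_, fun Q hQ => ?_, fun R hR => ?_⟩
      · rw [mem_sphere_zero_iff_norm, norm_smul, norm_inv, norm_norm, inv_mul_cancel₀ hn0.ne']
      · rw [real_inner_smul_left]
        exact mul_pos hn1 (hpos Q hQ)
      · rw [real_inner_smul_left]
        exact mul_neg_of_pos_of_neg hn1 (hneg R hR)
  · rintro ⟨⟨P, -, h₁, h₂⟩, -⟩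
    exact Set.eq_empty_of_forall_notMem fun Q hQ => (h₁ Q hQ.1).not_gt (h₂ Q hQ.2)
end
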